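/- arXiv:2601.18039 — 9 statements merged into one kernel-verified Lean document; each statement's English description precedes it below -/
import Mathlib

section
/- Let K be a field and let a, b, c ∈ K be nonzero with ac + b ≠ 0. Define, for nonzero t ∈ K, the 3×3 matrices A₁(t) = [[t⁻¹, 1, 0], [0, t, 0], [0, 0, 1]] and A₂(t) = [[1, 0, 0], [0, t⁻¹, 1], [0, 0, t]]. Then A₁(c)·A₂(b)·A₁(a) = A₂(c′)·A₁(b′)·A₂(a′), where a′ = bc/(ac + b), b′ = ac, and c′ = (ac + b)/c. -/
open Matrix

/-- The Berenstein–Zelevinsky matrix `A₁(t)`. -/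
def BZ1 {K : Type*} [Field K] (t : K) : Matrix (Fin 3) (Fin 3) K :=
  !![t⁻¹, 1, 0; 0, t, 0; 0, 0, 1]

/-- The Berenstein–Zelevinsky matrix `A₂(t)`. -/
def BZ2 {K : Type*} [Field K] (t : K) : Matrix (Fin 3) (Fin 3) K :=
  !![1, 0, 0; 0, t⁻¹, 1; 0, 0, t]

/-- Braid relation for the Berenstein–Zelevinsky transformations. -/
theorem bz_braid_relation {K : Type*} [Field K] (a b c : K)
    (ha : a ≠ 0) (hb : b ≠ 0) (hc : c ≠ 0) (habc : a * c + b ≠ 0) :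
    BZ1 c * BZ2 b * BZ1 a =
      BZ2 ((a * c + b) / c) * BZ1 (a * c) * BZ2 (b * c / (a * c + b)) := by
  have hca : c * a + b ≠ 0 := by rwa [mul_comm c a]
  ext i j
  fin_cases i <;> fin_cases j <;>
    simp [BZ1, BZ2, Matrix.mul_apply, Fin.sum_univ_three] <;> field_simp; ring
end

section
/- Let R be a commutative ring, k ≥ 1, and u₁, …, u_{k+1} ∈ R[x]. Set W = Wr(u₁, …, u_k), Ŵ = Wr(u₁, …, u_{k−1}, u_{k+1}), W₋ = Wr(u₁, …, u_{k−1}) and W₊ = Wr(u₁, …, u_{k+1}). Then W·Ŵ′ − W′·Ŵ = W₋·W₊, where ′ denotes the formal derivative; that is, Wr(W, Ŵ) = W₋·W₊. -/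
open Polynomial

/-- The Wronskian of a family of `k` polynomials: the determinant of the `k × k`
matrix whose `(i, j)` entry is the `i`-th formal derivative of `u j` (0-based). -/
noncomputable def wronskian' {R : Type*} [CommRing R] {k : ℕ} (u : Fin k → R[X]) : R[X] :=
  (Matrix.of fun i j : Fin k => (derivative^[(i : ℕ)] (u j))).det

namespace Matrix

variable {S m n : Type*} [CommRing S] [Fintype m] [DecidableEq m]

lemma det_pow_mul_det_fromBlocks [Fintype n] [DecidableEq n] (A : Matrix m m S)
    (B : Matrix m n S) (C : Matrix n m S) (D : Matrix n n S) :
    A.det ^ Fintype.card n * (fromBlocks A B C D).det =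
      A.det * (A.det • D - C * A.adjugate * B).det := by
  have h : fromBlocks A B C D * fromBlocks 1 (-(A.adjugate * B)) 0 (A.det • 1) =
      fromBlocks A 0 C (A.det • D - C * A.adjugate * B) := by
    rw [fromBlocks_multiply]
    congr 1
    · simp
    · simp [← Matrix.mul_assoc, mul_adjugate]
    · simp
    · simp [← Matrix.mul_assoc, sub_eq_neg_add]
  have hdet := congrArg det h
  rw [det_mul, det_fromBlocks_zero₁₂, det_fromBlocks_zero₂₁, det_one, one_mul, det_smul, det_one,
    mul_one] at hdet
  rw [mul_comm, hdet]

/-- The determinant of `A` bordered by column `j` of `B`, row `i` of `C` and the entry `D i j`. -/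
def borderedDet (A : Matrix m m S) (B : Matrix m n S) (C : Matrix n m S) (D : Matrix n n S)
    (i j : n) : S :=
  (fromBlocks A (B.submatrix id fun _ : Fin 1 => j) (C.submatrix (fun _ : Fin 1 => i) id)
    (D.submatrix (fun _ : Fin 1 => i) fun _ : Fin 1 => j)).det

lemma borderedDet_eq_of_isRegular {A : Matrix m m S} (hA : IsRegular A.det) (B : Matrix m n S)
    (C : Matrix n m S) (D : Matrix n n S) (i j : n) :
    borderedDet A B C D i j = (A.det • D - C * A.adjugate * B) i j := by
  apply hA.left
  have h := det_pow_mul_det_fromBlocks A (B.submatrix id fun _ : Fin 1 => j)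
    (C.submatrix (fun _ : Fin 1 => i) id) (D.submatrix (fun _ : Fin 1 => i) fun _ : Fin 1 => j)
  rw [Fintype.card_fin, pow_one] at h
  refine h.trans ?_
  congr 1
  simp [det_unique, Matrix.mul_apply]

lemma det_mul_det_fromBlocks_of_isRegular {A : Matrix m m S} (hA : IsRegular A.det)
    (B : Matrix m (Fin 2) S) (C : Matrix (Fin 2) m S) (D : Matrix (Fin 2) (Fin 2) S) :
    A.det * (fromBlocks A B C D).det = det (of (borderedDet A B C D)) := by
  have h : of (borderedDet A B C D) = A.det • D - C * A.adjugate * B :=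
    Matrix.ext (borderedDet_eq_of_isRegular hA B C D)
  apply hA.left
  have hdet := det_pow_mul_det_fromBlocks A B C D
  rw [Fintype.card_fin, pow_two, mul_assoc] at hdet
  rw [h]
  exact hdet

lemma map_C_map_eval_zero {p q : Type*} (N : Matrix p q S) :
    (N.map Polynomial.C).map (eval 0) = N := by
  ext
  simp

lemma eval_zero_det (N : Matrix m m S[X]) : eval 0 N.det = (N.map (eval 0)).det :=
  RingHom.map_det (evalRingHom 0) N

/-- Sylvester's determinant identity for two bordering rows and columns. -/
lemma det_mul_det_fromBlocks (A : Matrix m m S)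
    (B : Matrix m (Fin 2) S) (C : Matrix (Fin 2) m S) (D : Matrix (Fin 2) (Fin 2) S) :
    A.det * (fromBlocks A B C D).det = det (of (borderedDet A B C D)) := by
  have hreg : IsRegular (charmatrix (-A)).det := (charpoly_monic (-A)).isRegular
  have h := congrArg (eval 0) (det_mul_det_fromBlocks_of_isRegular hreg
    (B.map Polynomial.C) (C.map Polynomial.C) (D.map Polynomial.C))
  have hA : (charmatrix (-A)).map (eval 0) = A := by
    ext i j
    by_cases hij : i = j <;> simp [hij]
  simpa only [borderedDet, det_fin_two, of_apply, eval_sub, eval_mul, eval_zero_det,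
    fromBlocks_map, hA, map_C_map_eval_zero, submatrix_map] using h

end Matrix

lemma Polynomial.derivative_det {R n : Type*} [CommRing R] [Fintype n] [DecidableEq n]
    (M : Matrix n n R[X]) :
    derivative M.det = ∑ i, (M.updateRow i fun j => derivative (M i j)).det := by
  simp_rw [← Matrix.det_transpose M, ← Matrix.det_transpose (M.updateRow _ _), Matrix.det_apply]
  rw [Finset.sum_comm, derivative_sum]
  refine Finset.sum_congr rfl fun σ _ => ?_
  rw [← Finset.smul_sum, Units.smul_def, derivative_smul, derivative_prod_finset]
  congr 1
  refine Finset.sum_congr rfl fun i _ => ?_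
  rw [← Finset.mul_prod_erase _ _ (Finset.mem_univ i), mul_comm]
  congr 1
  · simp
  · refine Finset.prod_congr rfl fun k hk => ?_
    simp [Matrix.updateRow_ne (Finset.ne_of_mem_erase hk)]

lemma derivative_wronskian' {R : Type*} [CommRing R] {m : ℕ} (v : Fin (m + 1) → R[X]) :
    derivative (wronskian' v) = (Matrix.of fun i j : Fin (m + 1) =>
      derivative^[if (i : ℕ) < m then (i : ℕ) else m + 1] (v j)).det := by
  rw [wronskian', derivative_det, Fin.sum_univ_castSucc, Finset.sum_eq_zero, zero_add]
  · congr 1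
    ext1 i j
    induction i using Fin.lastCases with
    | last => simp [Function.iterate_succ_apply']
    | cast i => simp
  · intro i _
    have hi : i.succ ≠ i.castSucc := Fin.castSucc_lt_succ.ne'
    refine Matrix.det_zero_of_row_eq hi ?_
    ext1 j
    simp [Matrix.updateRow_ne hi, Function.iterate_succ_apply']

/-- Wronskian identity: for polynomials `u₁, …, u_{k+1}` (here `k = m + 1 ≥ 1`), with
`W = Wr(u₁,…,u_k)`, `Ŵ = Wr(u₁,…,u_{k-1},u_{k+1})`, `W₋ = Wr(u₁,…,u_{k-1})` and
`W₊ = Wr(u₁,…,u_{k+1})`, one has `W·Ŵ′ − W′·Ŵ = W₋·W₊`. -/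
theorem wronskian_identity {R : Type*} [CommRing R] (m : ℕ) (u : Fin (m + 2) → R[X]) :
    let W : R[X] := wronskian' fun i : Fin (m + 1) => u i.castSucc
    let What : R[X] := wronskian' fun i : Fin (m + 1) =>
      u (if (i : ℕ) < m then i.castSucc else Fin.last (m + 1))
    let Wminus : R[X] := wronskian' fun i : Fin m => u i.castSucc.castSucc
    let Wplus : R[X] := wronskian' u
    W * derivative What - derivative W * What = Wminus * Wplus := by
  intro W What Wminus Wplus
  let M : Matrix (Fin m ⊕ Fin 2) (Fin m ⊕ Fin 2) R[X] :=
    (Matrix.of fun i j : Fin (m + 2) => derivative^[(i : ℕ)] (u j)).submatrix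
      finSumFinEquiv finSumFinEquiv
  have hplus : Wplus = M.det := (Matrix.det_submatrix_equiv_self _ _).symm
  have hminus : Wminus = M.toBlocks₁₁.det := rfl
  have h (i j : Fin 2) :
      Matrix.borderedDet M.toBlocks₁₁ M.toBlocks₁₂ M.toBlocks₂₁ M.toBlocks₂₂ i j =
      (Matrix.of fun a b : Fin (m + 1) => derivative^[if (a : ℕ) < m then (a : ℕ) else m + i]
        (u (if (b : ℕ) < m then b.castSucc else Fin.natAdd m j))).det := by
    rw [← Matrix.det_submatrix_equiv_self (finSumFinEquiv (m := m) (n := 1))]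
    unfold Matrix.borderedDet
    congr 1
    ext1 a b
    rcases a with a | a <;> rcases b with b | b <;>
      simp [M, Matrix.toBlocks₁₁, Matrix.toBlocks₁₂, Matrix.toBlocks₂₁, Matrix.toBlocks₂₂] <;> rfl
  have hrow (a : Fin (m + 1)) : (if (a : ℕ) < m then (a : ℕ) else m) = a := by
    split_ifs <;> omega
  have hcol (b : Fin (m + 1)) :
      (if (b : ℕ) < m then b.castSucc else Fin.natAdd m (0 : Fin 2)) = b.castSucc := by
    split_ifs
    · rfl
    · ext; simp; omega
  have hlast : Fin.natAdd m (1 : Fin 2) = Fin.last (m + 1) := rfl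
  have key := Matrix.det_mul_det_fromBlocks M.toBlocks₁₁ M.toBlocks₁₂ M.toBlocks₂₁ M.toBlocks₂₂
  rw [Matrix.fromBlocks_toBlocks, ← hplus, ← hminus, Matrix.det_fin_two] at key
  rw [key, derivative_wronskian', derivative_wronskian']
  simp only [Matrix.of_apply, h, Fin.val_zero, Fin.val_one, add_zero, hrow, hcol, hlast]
  simp only [W, What, wronskian']
  ring
end

section
/- Let R be a commutative ring. For a, b, c ∈ R write A(a,b,c) for the 2×2 matrix [[a, b], [c, 0]]. For elements a₁,b₁,c₁,a₂,b₂,c₂,a₃,b₃,c₃ and a₁′,b₁′,c₁′,a₂′,b₂′,c₂′,a₃′,b₃′,c₃′ of R, the 3×3 matrix equation A(a₁,b₁,c₁)₁ · A(a₂,b₂,c₂)₂ · A(a₃,b₃,c₃)₁ = A(a₁′,b₁′,c₁′)₂ · A(a₂′,b₂′,c₂′)₁ · A(a₃′,b₃′,c₃′)₂ holds if and only if the following six scalar equations hold: a₁a₃ + a₂b₁c₃ = a₂′; a₁b₃ = b₂′a₃′; b₁b₂ = b₂′b₃′; c₁a₃ = a₁′c₂′; c₂c₃ = c₁′c₂′;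 c₁b₃ = b₁′c₃′. -/
open Matrix

/-- Embedding of a `2 × 2` matrix into `3 × 3` acting on rows/columns 1 and 2. -/
def emb1 {R : Type*} [CommRing R] (M : Matrix (Fin 2) (Fin 2) R) : Matrix (Fin 3) (Fin 3) R :=
  !![M 0 0, M 0 1, 0; M 1 0, M 1 1, 0; 0, 0, 1]

/-- Embedding of a `2 × 2` matrix into `3 × 3` acting on rows/columns 2 and 3. -/
def emb2 {R : Type*} [CommRing R] (M : Matrix (Fin 2) (Fin 2) R) : Matrix (Fin 3) (Fin 3) R :=
  !![1, 0, 0; 0, M 0 0, M 0 1; 0, M 1 0, M 1 1]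

/-- The matrix `A(a,b,c) = [[a,b],[c,0]]`. -/
def Aabc {R : Type*} [CommRing R] (a b c : R) : Matrix (Fin 2) (Fin 2) R :=
  !![a, b; c, 0]

/-- The defining system (RC1)–(RC6) of the `R`-correspondence: the `3 × 3` matrix
equation is equivalent to six scalar equations. -/
theorem rCorrespondence_iff {R : Type*} [CommRing R]
    (a₁ b₁ c₁ a₂ b₂ c₂ a₃ b₃ c₃ a₁' b₁' c₁' a₂' b₂' c₂' a₃' b₃' c₃' : R) :
    emb1 (Aabc a₁ b₁ c₁) * emb2 (Aabc a₂ b₂ c₂) * emb1 (Aabc a₃ b₃ c₃) =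
      emb2 (Aabc a₁' b₁' c₁') * emb1 (Aabc a₂' b₂' c₂') * emb2 (Aabc a₃' b₃' c₃') ↔
    (a₁ * a₃ + a₂ * b₁ * c₃ = a₂' ∧
     a₁ * b₃ = b₂' * a₃' ∧
     b₁ * b₂ = b₂' * b₃' ∧
     c₁ * a₃ = a₁' * c₂' ∧
     c₂ * c₃ = c₁' * c₂' ∧
     c₁ * b₃ = b₁' * c₃') := by
  rw [← Matrix.ext_iff]
  simp [emb1, emb2, Aabc, Fin.forall_fin_succ, Matrix.mul_apply, Fin.sum_univ_succ,
    mul_comm b₁ a₂, and_assoc,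
    and_comm (a := c₁ * b₃ = b₁' * c₃')]
end

section
/- Let K be a field and let a₁, b₁, a₂, b₂, a₃, b₃, a₁′ be nonzero elements of K. Define b₁′ = a₃b₂b₃/(a₁′b₁), a₂′ = (a₁a₃b₃ + a₂b₁)/b₃, b₂′ = a₁′b₁/a₃, a₃′ = a₁a₃b₃/(a₁′b₁), b₃′ = a₃b₂/a₁′. Then, with A(a,b) denoting the 2×2 matrix [[a, b], [b⁻¹, 0]], the 3×3 matrix equation A(a₁,b₁)₁ · A(a₂,b₂)₂ · A(a₃,b₃)₁ = A(a₁′,b₁′)₂ · A(a₂′,b₂′)₁ · A(a₃′,b₃′)₂ holds. -/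
open Matrix

/-- The matrix `A(a,b) = [[a,b],[b⁻¹,0]]` of the smaller, two-parameter
`R`-correspondence. -/
def Aab {K : Type*} [Field K] (a b : K) : Matrix (Fin 2) (Fin 2) K :=
  !![a, b; b⁻¹, 0]

/-- The smaller, two-parameter `R`-correspondence with free parameter `a₁′`. -/
theorem smaller_rCorrespondence {K : Type*} [Field K]
    (a₁ b₁ a₂ b₂ a₃ b₃ a₁' : K)
    (ha₁ : a₁ ≠ 0) (hb₁ : b₁ ≠ 0) (ha₂ : a₂ ≠ 0) (hb₂ : b₂ ≠ 0)
    (ha₃ : a₃ ≠ 0) (hb₃ : b₃ ≠ 0) (ha₁' : a₁' ≠ 0) :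
    emb1 (Aab a₁ b₁) * emb2 (Aab a₂ b₂) * emb1 (Aab a₃ b₃) =
      emb2 (Aab a₁' (a₃ * b₂ * b₃ / (a₁' * b₁))) *
        emb1 (Aab ((a₁ * a₃ * b₃ + a₂ * b₁) / b₃) (a₁' * b₁ / a₃)) *
        emb2 (Aab (a₁ * a₃ * b₃ / (a₁' * b₁)) (a₃ * b₂ / a₁')) := by
  ext i j
  fin_cases i <;> fin_cases j <;>
    simp [emb1, emb2, Aab, Matrix.mul_apply, Fin.sum_univ_three] <;> field_simp
end

section
/- Let K be a field. For nonzero α ∈ K define the transformation 𝐑_α on triples of pairs by 𝐑_α((a₁,b₁),(a₂,b₂),(a₃,b₃)) = ((α, a₃b₂b₃/(α b₁)), ((a₁a₃b₃ + a₂b₁)/b₃, α b₁/a₃), (a₁a₃b₃/(α b₁), a₃b₂/α)). For a 6-tuple of pairs t = ((a_i,b_i))_{i=1..6}, let 𝐑(k)_α apply 𝐑_α to the pairs in positions k, k+1, k+2 (1 ≤ k ≤ 4) leaving the others fixed, and let 𝐋(k) swap the pairs in positions k and k+1 (1 ≤ k ≤ 5). Suppose a₁,…,a₆,b₁,…,b₆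 ∈ K are nonzero, a₅b₃ + a₃a₆b₆ ≠ 0, and all denominators occurring in the compositions below are nonzero. Let π, σ, ρ, τ, τ₁ be nonzero parameters with σ = a₅b₄/b₆, τ = a₆b₄b₅b₆/(b₁b₂b₃), and π·ρ = a₁a₃a₆b₆²/(b₄(a₅b₃ + a₃a₆b₆)), and τ₁ arbitrary nonzero. Then 𝐋(3) ∘ 𝐑(1)_{τ} ∘ 𝐑(3)_{ρ} ∘ 𝐋(5) ∘ 𝐋(2) ∘ 𝐑(3)_{σ} ∘ 𝐑(1)_{π} applied to t equals 𝐑(4)_{a₃b₁b₂/(b₅b₆)} ∘ 𝐑(2)_{a₁b₆/b₄} ∘ 𝐋(1) ∘ 𝐋(4) ∘ 𝐑(2)_{τ} ∘ 𝐑(4)_{τ₁} ∘ 𝐋(3) applied to t. -/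
/-- The transformation `𝐑_α` on a triple of pairs:
`𝐑_α((a₁,b₁),(a₂,b₂),(a₃,b₃)) = ((α, a₃b₂b₃/(αb₁)), ((a₁a₃b₃+a₂b₁)/b₃, αb₁/a₃),
(a₁a₃b₃/(αb₁), a₃b₂/α))`. -/
def tripleR {K : Type*} [Field K] (α : K) (p q r : K × K) : (K × K) × (K × K) × (K × K) :=
  ((α, r.1 * q.2 * r.2 / (α * p.2)),
   ((p.1 * r.1 * r.2 + q.1 * p.2) / r.2, α * p.2 / r.1),
   (p.1 * r.1 * r.2 / (α * p.2), r.1 * q.2 / α))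

/-- `𝐑(k)_α` applied to a 6-tuple of pairs: acts by `𝐑_α` on positions `k, k+1, k+2`
(0-based `k`), leaving the other positions fixed. -/
def Rmv {K : Type*} [Field K] (α : K) (k : Fin 6) (t : Fin 6 → K × K) : Fin 6 → K × K :=
  fun m =>
    if m = k then (tripleR α (t k) (t (k + 1)) (t (k + 2))).1
    else if m = k + 1 then (tripleR α (t k) (t (k + 1)) (t (k + 2))).2.1
    else if m = k + 2 then (tripleR α (t k) (t (k + 1)) (t (k + 2))).2.2
    else t m

/-- `𝐋(k)`: swap the pairs in positions `k` and `k+1` (0-based `k`). -/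
def Lmv {K : Type*} [Field K] (k : Fin 6) (t : Fin 6 → K × K) : Fin 6 → K × K :=
  fun m => if m = k then t (k + 1) else if m = k + 1 then t k else t m

section Literals

variable {K : Type*} [Field K] (α : K) (p₀ p₁ p₂ p₃ p₄ p₅ : K × K)

theorem Rmv_zero_vec :
    Rmv α 0 ![p₀, p₁, p₂, p₃, p₄, p₅] =
      ![(tripleR α p₀ p₁ p₂).1,
        (tripleR α p₀ p₁ p₂).2.1,
        (tripleR α p₀ p₁ p₂).2.2, p₃, p₄, p₅] := by
  funext m
  fin_cases m <;> rfl

theorem Rmv_one_vec :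
    Rmv α 1 ![p₀, p₁, p₂, p₃, p₄, p₅] =
      ![p₀, (tripleR α p₁ p₂ p₃).1,
        (tripleR α p₁ p₂ p₃).2.1,
        (tripleR α p₁ p₂ p₃).2.2, p₄, p₅] := by
  funext m
  fin_cases m <;> rfl

theorem Rmv_two_vec :
    Rmv α 2 ![p₀, p₁, p₂, p₃, p₄, p₅] =
      ![p₀, p₁, (tripleR α p₂ p₃ p₄).1,
        (tripleR α p₂ p₃ p₄).2.1,
        (tripleR α p₂ p₃ p₄).2.2, p₅] := by
  funext m
  fin_cases m <;> rfl

theorem Rmv_three_vec :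
    Rmv α 3 ![p₀, p₁, p₂, p₃, p₄, p₅] =
      ![p₀, p₁, p₂, (tripleR α p₃ p₄ p₅).1,
        (tripleR α p₃ p₄ p₅).2.1,
        (tripleR α p₃ p₄ p₅).2.2] := by
  funext m
  fin_cases m <;> rfl

theorem Lmv_zero_vec :
    Lmv 0 ![p₀, p₁, p₂, p₃, p₄, p₅] =
      ![p₁, p₀, p₂, p₃, p₄, p₅] := by
  funext m
  fin_cases m <;> rfl

theorem Lmv_one_vec :
    Lmv 1 ![p₀, p₁, p₂, p₃, p₄, p₅] =
      ![p₀, p₂, p₁, p₃, p₄, p₅] := by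
  funext m
  fin_cases m <;> rfl

theorem Lmv_two_vec :
    Lmv 2 ![p₀, p₁, p₂, p₃, p₄, p₅] =
      ![p₀, p₁, p₃, p₂, p₄, p₅] := by
  funext m
  fin_cases m <;> rfl

theorem Lmv_three_vec :
    Lmv 3 ![p₀, p₁, p₂, p₃, p₄, p₅] =
      ![p₀, p₁, p₂, p₄, p₃, p₅] := by
  funext m
  fin_cases m <;> rfl

theorem Lmv_four_vec :
    Lmv 4 ![p₀, p₁, p₂, p₃, p₄, p₅] =
      ![p₀, p₁, p₂, p₃, p₅, p₄] := by
  funext m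
  fin_cases m <;> rfl

end Literals

/-- The sonnet (tetrahedron) equation for the smaller, two-parameter `R`-correspondence:
the upper-road composition `𝐋(3)𝐑(1)_τ𝐑(3)_ρ𝐋(5)𝐋(2)𝐑(3)_σ𝐑(1)_π` and the lower-road
composition `𝐑(4)_{a₃b₁b₂/(b₅b₆)}𝐑(2)_{a₁b₆/b₄}𝐋(1)𝐋(4)𝐑(2)_τ𝐑(4)_{τ₁}𝐋(3)` agree,
provided `σ = a₅b₄/b₆`, `τ = a₆b₄b₅b₆/(b₁b₂b₃)` and `π·ρ = a₁a₃a₆b₆²/(b₄(a₅b₃+a₃a₆b₆))`.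
(Moves are written with 0-based positions: `𝐑(k)` acts at positions `k-1,k,k+1` and
`𝐋(k)` swaps positions `k-1,k` of the 1-based statement.) -/
theorem sonnet_smaller_rCorrespondence {K : Type*} [Field K]
    (a₁ b₁ a₂ b₂ a₃ b₃ a₄ b₄ a₅ b₅ a₆ b₆ π σ ρ τ τ₁ : K)
    (ha₁ : a₁ ≠ 0) (ha₂ : a₂ ≠ 0) (ha₃ : a₃ ≠ 0) (ha₄ : a₄ ≠ 0) (ha₅ : a₅ ≠ 0)
    (ha₆ : a₆ ≠ 0)
    (hb₁ : b₁ ≠ 0) (hb₂ : b₂ ≠ 0) (hb₃ : b₃ ≠ 0) (hb₄ : b₄ ≠ 0) (hb₅ : b₅ ≠ 0)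
    (hb₆ : b₆ ≠ 0)
    (hden : a₅ * b₃ + a₃ * a₆ * b₆ ≠ 0)
    (hπ : π ≠ 0) (hσ : σ ≠ 0) (hρ : ρ ≠ 0) (hτ : τ ≠ 0) (hτ₁ : τ₁ ≠ 0)
    (hσval : σ = a₅ * b₄ / b₆)
    (hτval : τ = a₆ * b₄ * b₅ * b₆ / (b₁ * b₂ * b₃))
    (hπρ : π * ρ = a₁ * a₃ * a₆ * b₆ ^ 2 / (b₄ * (a₅ * b₃ + a₃ * a₆ * b₆)))
    (t : Fin 6 → K × K)
    (ht : t = ![(a₁, b₁), (a₂, b₂), (a₃, b₃), (a₄, b₄), (a₅, b₅), (a₆, b₆)]) :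
    Lmv 2 (Rmv τ 0 (Rmv ρ 2 (Lmv 4 (Lmv 1 (Rmv σ 2 (Rmv π 0 t)))))) =
      Rmv (a₃ * b₁ * b₂ / (b₅ * b₆)) 3
        (Rmv (a₁ * b₆ / b₄) 1 (Lmv 0 (Lmv 3 (Rmv τ 1 (Rmv τ₁ 3 (Lmv 2 t)))))) := by
  have hρval : ρ = a₁ * a₃ * a₆ * b₆ ^ 2 / (b₄ * (a₅ * b₃ + a₃ * a₆ * b₆)) / π := by
    rw [← hπρ, mul_div_cancel_left₀ _ hπ]
  subst ht hρval hτval hσval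
  simp only [Rmv_zero_vec, Rmv_one_vec, Rmv_two_vec, Rmv_three_vec, Lmv_zero_vec, Lmv_one_vec,
    Lmv_two_vec, Lmv_three_vec, Lmv_four_vec, tripleR]
  -- `field_simp` meets the denominator `a₅ * b₃ + a₃ * a₆ * b₆` in several normal forms.
  have hden₁ : a₃ * a₆ * b₆ + a₅ * b₃ ≠ 0 := by rwa [add_comm]
  have hden₂ : a₃ * b₆ * a₆ + b₃ * a₅ ≠ 0 := by convert hden using 1; ring
  funext m
  fin_cases m <;> refine Prod.ext ?_ ?_ <;> dsimp <;> field_simp <;> ring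
end

section
/- Let R be a commutative ring and let A, B, C be 2×2 matrices over R that are c-upper triangular, i.e. A₂₂ = B₂₂ = C₂₂ = 0. Then both 3×3 products A_{12}·B_{13}·C_{23} and A_{23}·B_{13}·C_{12} are c-upper triangular, i.e. their (2,3), (3,2) and (3,3) entries all vanish. -/
open Matrix

/-- Embedding of a `2 × 2` matrix into `3 × 3` acting on rows/columns 1 and 2. -/
def emb12 {R : Type*} [CommRing R] (M : Matrix (Fin 2) (Fin 2) R) : Matrix (Fin 3) (Fin 3) R :=
  !![M 0 0, M 0 1, 0; M 1 0, M 1 1, 0; 0, 0, 1]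

/-- Embedding of a `2 × 2` matrix into `3 × 3` acting on rows/columns 2 and 3. -/
def emb23 {R : Type*} [CommRing R] (M : Matrix (Fin 2) (Fin 2) R) : Matrix (Fin 3) (Fin 3) R :=
  !![1, 0, 0; 0, M 0 0, M 0 1; 0, M 1 0, M 1 1]

/-- Embedding of a `2 × 2` matrix into `3 × 3` acting on rows/columns 1 and 3. -/
def emb13 {R : Type*} [CommRing R] (M : Matrix (Fin 2) (Fin 2) R) : Matrix (Fin 3) (Fin 3) R :=
  !![M 0 0, 0, M 0 1; 0, 1, 0; M 1 0, 0, M 1 1]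

/-- A `3 × 3` matrix is c-upper triangular if its entries strictly below the antidiagonal
vanish, i.e. its `(2,3)`, `(3,2)` and `(3,3)` entries (1-based) are zero. -/
def cUpper3 {R : Type*} [CommRing R] (M : Matrix (Fin 3) (Fin 3) R) : Prop :=
  M 1 2 = 0 ∧ M 2 1 = 0 ∧ M 2 2 = 0

/-- Triangularity Lemma: if `A, B, C` are c-upper triangular `2 × 2` matrices
(`A₂₂ = B₂₂ = C₂₂ = 0`), then both products `A₁₂·B₁₃·C₂₃` and `A₂₃·B₁₃·C₁₂`
are c-upper triangular `3 × 3` matrices. -/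
theorem triangularity_lemma {R : Type*} [CommRing R]
    (A B C : Matrix (Fin 2) (Fin 2) R)
    (hA : A 1 1 = 0) (hB : B 1 1 = 0) (hC : C 1 1 = 0) :
    cUpper3 (emb12 A * emb13 B * emb23 C) ∧ cUpper3 (emb23 A * emb13 B * emb12 C) := by
  simp [cUpper3, emb12, emb13, emb23, Matrix.mul_apply, Fin.sum_univ_three, hA, hB, hC]
end

section
/- Let K be a field, A(t) = [[t, 1], [1, 0]], and let a₁, a₂, a₃, a₁′, a₂′, a₃′ ∈ K. Then the 3×3 matrix equation A(a₁)_{12}·A(a₂)_{13}·A(a₃)_{23} = A(a₁′)_{23}·A(a₂′)_{13}·A(a₃′)_{12} holds if and only if a₁a₂ = a₂′a₃′, a₁ + a₃ = a₂′, and a₂ = a₁′ + a₃′. In particular, if a₁ + a₃ ≠ 0, the equation holds with a₁′ = a₂a₃/(a₁ + a₃), a₂′ = a₁ + a₃, a₃′ = a₁a₂/(a₁ + a₃). -/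
open Matrix

/-- The matrix `A(t) = [[t,1],[1,0]]`. -/
def At {K : Type*} [Field K] (t : K) : Matrix (Fin 2) (Fin 2) K :=
  !![t, 1; 1, 0]

theorem emb12_mul_emb13_mul_emb23_At {K : Type*} [Field K] (a b c : K) :
    emb12 (At a) * emb13 (At b) * emb23 (At c) = !![a * b, a + c, 1; b, 1, 0; 1, 0, 0] := by
  ext i j
  fin_cases i <;> fin_cases j <;>
    simp [emb12, emb13, emb23, At, Matrix.mul_apply, Fin.sum_univ_three, add_comm]

theorem emb23_mul_emb13_mul_emb12_At {K : Type*} [Field K] (a b c : K) :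
    emb23 (At a) * emb13 (At b) * emb12 (At c) = !![b * c, b, 1; a + c, 1, 0; 1, 0, 0] := by
  ext i j
  fin_cases i <;> fin_cases j <;>
    simp [emb12, emb13, emb23, At, Matrix.mul_apply, Fin.sum_univ_three, add_comm]

theorem emb_At_mul_eq_iff {K : Type*} [Field K] (a₁ a₂ a₃ a₁' a₂' a₃' : K) :
    emb12 (At a₁) * emb13 (At a₂) * emb23 (At a₃) =
        emb23 (At a₁') * emb13 (At a₂') * emb12 (At a₃') ↔
      (a₁ * a₂ = a₂' * a₃' ∧ a₁ + a₃ = a₂' ∧ a₂ = a₁' + a₃') := by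
  rw [emb12_mul_emb13_mul_emb23_At, emb23_mul_emb13_mul_emb12_At]
  constructor
  · intro h
    exact ⟨congrFun₂ h 0 0, congrFun₂ h 0 1, congrFun₂ h 1 0⟩
  · rintro ⟨h₁, h₂, h₃⟩
    rw [h₁, h₂, h₃]

/-- The `R`-matrix of Section 9.3: the matrix equation
`A(a₁)₁₂·A(a₂)₁₃·A(a₃)₂₃ = A(a₁′)₂₃·A(a₂′)₁₃·A(a₃′)₁₂` is equivalent to the three scalar
equations `a₁a₂ = a₂′a₃′`, `a₁+a₃ = a₂′`, `a₂ = a₁′+a₃′`; in particular, when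
`a₁+a₃ ≠ 0` it holds for `a₁′ = a₂a₃/(a₁+a₃)`, `a₂′ = a₁+a₃`, `a₃′ = a₁a₂/(a₁+a₃)`. -/
theorem another_triple_R {K : Type*} [Field K] (a₁ a₂ a₃ a₁' a₂' a₃' : K) :
    (emb12 (At a₁) * emb13 (At a₂) * emb23 (At a₃) =
        emb23 (At a₁') * emb13 (At a₂') * emb12 (At a₃') ↔
      (a₁ * a₂ = a₂' * a₃' ∧ a₁ + a₃ = a₂' ∧ a₂ = a₁' + a₃')) ∧
    (a₁ + a₃ ≠ 0 →
      emb12 (At a₁) * emb13 (At a₂) * emb23 (At a₃) =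
        emb23 (At (a₂ * a₃ / (a₁ + a₃))) * emb13 (At (a₁ + a₃)) *
          emb12 (At (a₁ * a₂ / (a₁ + a₃)))) := by
  refine ⟨emb_At_mul_eq_iff a₁ a₂ a₃ a₁' a₂' a₃', fun h => ?_⟩
  rw [emb_At_mul_eq_iff]
  refine ⟨?_, rfl, ?_⟩
  · field_simp
  · field_simp
    ring
end

section
/- Let K be a field and for nonzero t ∈ K and s ∈ K let B(t, s) = [[t⁻¹, s], [0, t]]. Let a, b, c, c′ ∈ K be nonzero and x, y, z ∈ K with D := z a⁻¹ b + x c ≠ 0. Set a′ = b/c′, b′ = ac, x′ = (z y b / c′)/D, y′ = (c′/b)·D, z′ = (x y b / c′)/D. Then the 3×3 matrix equation B(a, x)₁ · B(b, y)₂ · B(c, z)₁ = B(a′, x′)₂ · B(b′, y′)₁ · B(c′, z′)₂ holds. -/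
open Matrix

/-- The matrix `B(t, s) = [[t⁻¹, s], [0, t]]`. -/
def Bts {K : Type*} [Field K] (t s : K) : Matrix (Fin 2) (Fin 2) K :=
  !![t⁻¹, s; 0, t]

/-- The two-parametric upper-triangular correspondence (formula (bzL1)), encompassing
the Lusztig and Berenstein–Zelevinsky flips, with free parameter `c′`. -/
theorem two_parametric_upper_correspondence {K : Type*} [Field K]
    (a b c c' x y z : K)
    (ha : a ≠ 0) (hb : b ≠ 0) (hc : c ≠ 0) (hc' : c' ≠ 0)
    (hD : z * a⁻¹ * b + x * c ≠ 0) :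
    emb1 (Bts a x) * emb2 (Bts b y) * emb1 (Bts c z) =
      emb2 (Bts (b / c') (z * y * b / c' / (z * a⁻¹ * b + x * c))) *
        emb1 (Bts (a * c) (c' / b * (z * a⁻¹ * b + x * c))) *
        emb2 (Bts c' (x * y * b / c' / (z * a⁻¹ * b + x * c))) := by
  have hD' : z * b + a * x * c = a * (z * a⁻¹ * b + x * c) := by
    field_simp
  generalize hd : z * a⁻¹ * b + x * c = D at *
  ext i j
  fin_cases i <;> fin_cases j <;> simp [emb1, emb2, Bts, Matrix.mul_apply, Fin.sum_univ_three]
  · ring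
  · rw [← hd]
    field_simp
  · field_simp
  · field_simp
  · field_simp
    linear_combination (-y) * hD'
  · field_simp
end

section
/- Let K be a field, n ≥ 2, and N = n(n−1)/2. Let (i₁, …, i_N) be a sequence with 1 ≤ i_m ≤ n−1 such that the product of adjacent transpositions s_{i₁}·s_{i₂}·⋯·s_{i_N} (where s_i swaps i and i+1) equals the reversal permutation w₀ : j ↦ n+1−j of {1,…,n} (so the word is a reduced decomposition of w₀). For a, b, c ∈ K let A(a,b,c)_i denote the n×n matrix equal to the identity except for the 2×2 block [[a, b], [c, 0]] in rows and columns i, i+1. Then for any a₁,…,a_N, b₁,…,b_N, c₁,…,c_N ∈ K the product M = A(a₁,b₁,c₁)_{i₁}·A(a₂,b₂,c₂)_{i₂}·⋯·A(a_N,b_N,c_N)_{i_N} is c-upper triangular: M_{jk} = 0 whenever j + k > n + 1; and if moreover all b_m and c_m are nonzero, then M_{j, n+1−j} ≠ 0 for every j. -/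
open Matrix

/-- The adjacent transposition `s_m` of `{1,…,n}` (1-based `m`): it swaps the 0-based
indices `m-1` and `m` of `Fin n`, for `1 ≤ m < n` (and is the identity otherwise). -/
def adjSwap (n m : ℕ) : Equiv.Perm (Fin n) :=
  if h : m < n then Equiv.swap ⟨m - 1, lt_of_le_of_lt (Nat.sub_le m 1) h⟩ ⟨m, h⟩ else 1

/-- The `n × n` matrix equal to the identity except for the `2 × 2` block `[[a,b],[c,0]]`
in rows and columns `p, p+1` (0-based `p`). -/
def blockA {K : Type*} [Field K] (n p : ℕ) (a b c : K) : Matrix (Fin n) (Fin n) K :=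
  Matrix.of fun j k =>
    if (j : ℕ) = p ∧ (k : ℕ) = p then a
    else if (j : ℕ) = p ∧ (k : ℕ) = p + 1 then b
    else if (j : ℕ) = p + 1 ∧ (k : ℕ) = p then c
    else if (j : ℕ) = p + 1 ∧ (k : ℕ) = p + 1 then 0
    else if j = k then 1 else 0

/-- The inversions of a permutation `σ` of `Fin n`: the pairs `x < y` with `σ y < σ x`. -/
def inversions {n : ℕ} (σ : Equiv.Perm (Fin n)) : Finset (Fin n × Fin n) :=
  Finset.univ.filter fun p => p.1 < p.2 ∧ σ p.2 < σ p.1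

lemma mem_inversions {n : ℕ} {σ : Equiv.Perm (Fin n)} {p : Fin n × Fin n} :
    p ∈ inversions σ ↔ p.1 < p.2 ∧ σ p.2 < σ p.1 := by
  simp [inversions]

lemma inversions_one {n : ℕ} : inversions (1 : Equiv.Perm (Fin n)) = ∅ := by
  ext p
  simp only [mem_inversions, Equiv.Perm.one_apply, Finset.notMem_empty, iff_false]
  exact fun h => lt_asymm h.1 h.2

lemma card_inversions_revPerm (n : ℕ) :
    (inversions (Fin.revPerm : Equiv.Perm (Fin n))).card = n * (n - 1) / 2 := by
  have h : inversions (Fin.revPerm : Equiv.Perm (Fin n)) =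
      Finset.univ.filter fun p : Fin n × Fin n => p.1 < p.2 := by
    ext p
    simp [mem_inversions]
  rw [h, Finset.card_filter, Fintype.sum_prod_type_right, ← Finset.sum_range_id,
    ← Fin.sum_univ_eq_sum_range (fun i => i)]
  refine Finset.sum_congr rfl fun y _ => ?_
  rw [← Finset.card_filter, ← Fin.card_Iio y]
  congr 1
  ext x
  simp

lemma swap_lt_swap_of_lt {n : ℕ} {u v x y : Fin n} (huv : (v : ℕ) = u + 1) (hxy : x < y)
    (hne : ¬(x = u ∧ y = v)) : Equiv.swap u v x < Equiv.swap u v y := by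
  simp only [Equiv.swap_apply_def]
  split_ifs <;> simp only [Fin.ext_iff, Fin.lt_def] at * <;> omega

lemma mem_image_inversions_of_ne {n : ℕ} {u v : Fin n} (huv : (v : ℕ) = u + 1)
    {σ : Equiv.Perm (Fin n)} {p : Fin n × Fin n} (hp : p ∈ inversions (σ * Equiv.swap u v))
    (hne : p ≠ (u, v)) :
    p ∈ (inversions σ).image (Prod.map (Equiv.swap u v) (Equiv.swap u v)) := by
  rw [mem_inversions] at hp
  refine Finset.mem_image.2 ⟨(Equiv.swap u v p.1, Equiv.swap u v p.2), mem_inversions.2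
    ⟨swap_lt_swap_of_lt huv hp.1 fun h => hne (Prod.ext h.1 h.2), hp.2⟩, ?_⟩
  simp

lemma card_inversions_mul_swap_le {n : ℕ} {u v : Fin n} (huv : (v : ℕ) = u + 1)
    (σ : Equiv.Perm (Fin n)) :
    (inversions (σ * Equiv.swap u v)).card ≤ (inversions σ).card + 1 := by
  refine (Finset.card_le_card (t := insert (u, v) ((inversions σ).image
    (Prod.map (Equiv.swap u v) (Equiv.swap u v)))) fun p hp => ?_).trans
    ((Finset.card_insert_le _ _).trans (Nat.add_le_add_right Finset.card_image_le 1))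
  by_cases h : p = (u, v)
  · exact Finset.mem_insert.2 (Or.inl h)
  · exact Finset.mem_insert_of_mem (mem_image_inversions_of_ne huv hp h)

lemma card_inversions_mul_swap_le_of_lt {n : ℕ} {u v : Fin n} (huv : (v : ℕ) = u + 1)
    {σ : Equiv.Perm (Fin n)} (hσ : σ v < σ u) :
    (inversions (σ * Equiv.swap u v)).card ≤ (inversions σ).card := by
  refine (Finset.card_le_card fun p hp => mem_image_inversions_of_ne huv hp ?_).trans
    Finset.card_image_le
  rintro rfl
  have h := (mem_inversions.1 hp).2
  simp only [Equiv.Perm.mul_apply, Equiv.swap_apply_left, Equiv.swap_apply_right] at h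
  exact lt_asymm h hσ

lemma adjSwap_eq_swap {n : ℕ} {u v : Fin n} {m : ℕ} (hu : m = u + 1) (hv : m = v) :
    adjSwap n m = Equiv.swap u v := by
  subst hv
  rw [adjSwap, dif_pos v.isLt]
  congr 1
  ext
  simp [hu]

lemma exists_adjacent {n m : ℕ} (h1 : 1 ≤ m) (h2 : m < n) :
    ∃ u v : Fin n, m = u + 1 ∧ m = v :=
  ⟨⟨m - 1, by omega⟩, ⟨m, h2⟩, by simp only; omega, rfl⟩

section blockA

variable {K : Type*} [Field K] {n : ℕ} {u v : Fin n} (huv : (v : ℕ) = u + 1) (a b c : K)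
  (M : Matrix (Fin n) (Fin n) K) (k : Fin n)

include huv

lemma blockA_mul_apply_left : (blockA n u a b c * M) u k = a * M u k + b * M v k := by
  have hne : u ≠ v := fun h => by simp [h] at huv
  rw [Matrix.mul_apply, Fintype.sum_eq_add u v hne]
  · simp [blockA, huv]
  · rintro x ⟨hxu, hxv⟩
    have h1 : (x : ℕ) ≠ u := fun h => hxu (Fin.ext h)
    have h2 : (x : ℕ) ≠ u + 1 := fun h => hxv (Fin.ext (h.trans huv.symm))
    simp [blockA, h1, h2, hxu.symm]

lemma blockA_mul_apply_right : (blockA n u a b c * M) v k = c * M u k := by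
  rw [Matrix.mul_apply, Fintype.sum_eq_single u]
  · simp [blockA, huv]
  · intro x hxu
    have h1 : (x : ℕ) ≠ u := fun h => hxu (Fin.ext h)
    by_cases hxv : x = v
    · simp [blockA, hxv, huv]
    · simp [blockA, h1, huv, Ne.symm hxv]

lemma blockA_mul_apply_of_ne {j : Fin n} (hju : j ≠ u) (hjv : j ≠ v) :
    (blockA n u a b c * M) j k = M j k := by
  have h1 : (j : ℕ) ≠ u := fun h => hju (Fin.ext h)
  have h2 : (j : ℕ) ≠ u + 1 := fun h => hjv (Fin.ext (h.trans huv.symm))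
  rw [Matrix.mul_apply, Fintype.sum_eq_single j]
  · simp [blockA, h1, h2]
  · intro x hx
    simp [blockA, h1, h2, hx.symm]

end blockA

lemma card_inversions_prod_adjSwap_le {n : ℕ} (L : List ℕ) (hL : ∀ m ∈ L, 1 ≤ m ∧ m < n) :
    (inversions (L.map (adjSwap n)).prod⁻¹).card ≤ L.length := by
  induction L with
  | nil => simp [inversions_one]
  | cons m L ih =>
    obtain ⟨h1, h2⟩ := hL m List.mem_cons_self
    obtain ⟨u, v, hu, hv⟩ := exists_adjacent h1 h2
    have := ih fun x hx => hL x (List.mem_cons_of_mem _ hx)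
    have := card_inversions_mul_swap_le (hv.symm.trans hu) (L.map (adjSwap n)).prod⁻¹
    rw [List.map_cons, List.prod_cons, _root_.mul_inv_rev, adjSwap_eq_swap hu hv, Equiv.swap_inv,
      List.length_cons]
    omega

/-- If a word `L` of adjacent transpositions with product `π` is reduced, then row `j` of the
corresponding product of block matrices vanishes beyond column `π⁻¹ j`, and its entry in that
column is nonzero when all the off-diagonal entries of the blocks are. -/
lemma prod_blockA_apply_of_reduced {K : Type*} [Field K] {n : ℕ} (L : List (ℕ × K × K × K))
    (hL : ∀ t ∈ L, 1 ≤ t.1 ∧ t.1 < n)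
    (hred : (inversions ((L.map Prod.fst).map (adjSwap n)).prod⁻¹).card = L.length) :
    (∀ j k : Fin n, ((L.map Prod.fst).map (adjSwap n)).prod⁻¹ j < k →
      (L.map fun t => blockA n (t.1 - 1) t.2.1 t.2.2.1 t.2.2.2).prod j k = 0) ∧
    ((∀ t ∈ L, t.2.2.1 ≠ 0 ∧ t.2.2.2 ≠ 0) → ∀ j : Fin n,
      (L.map fun t => blockA n (t.1 - 1) t.2.1 t.2.2.1 t.2.2.2).prod j
        (((L.map Prod.fst).map (adjSwap n)).prod⁻¹ j) ≠ 0) := by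
  induction L with
  | nil =>
    refine ⟨fun j k h => ?_, fun _ j => ?_⟩
    · simp only [List.map_nil, List.prod_nil, inv_one, Equiv.Perm.one_apply] at h ⊢
      exact Matrix.one_apply_ne h.ne
    · simp
  | cons t L ih =>
    obtain ⟨m, a, b, c⟩ := t
    obtain ⟨h1, h2⟩ := hL _ List.mem_cons_self
    obtain ⟨u, v, hu, hv⟩ := exists_adjacent h1 h2
    have hL' : ∀ t ∈ L, 1 ≤ t.1 ∧ t.1 < n := fun t ht => hL t (List.mem_cons_of_mem _ ht)
    have huv := hv.symm.trans hu
    have hlen := card_inversions_prod_adjSwap_le (n := n) (L.map Prod.fst) (by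
      intro m hm
      obtain ⟨t, ht, rfl⟩ := List.mem_map.1 hm
      exact hL' t ht)
    have hmu : m - 1 = u := by simp only at hu; omega
    simp only [List.map_cons, List.prod_cons, _root_.mul_inv_rev, adjSwap_eq_swap hu hv,
      Equiv.swap_inv, List.length_cons, List.length_map, hmu] at hred hlen ⊢
    specialize ih hL'
    generalize (L.map fun t => blockA n (t.1 - 1) t.2.1 t.2.2.1 t.2.2.2).prod = M at ih ⊢
    generalize ((L.map Prod.fst).map (adjSwap n)).prod⁻¹ = σ at *
    have hle := card_inversions_mul_swap_le huv σ
    obtain ⟨ih0, ih1⟩ := ih (by omega)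
    have hne : u ≠ v := fun h => by simp [h] at huv
    have hσ : σ u < σ v := by
      refine lt_of_le_of_ne (not_lt.1 fun h => ?_) (σ.injective.ne hne)
      have := card_inversions_mul_swap_le_of_lt huv h
      omega
    simp only [Equiv.Perm.mul_apply]
    refine ⟨fun j k hjk => ?_, fun hbc j => ?_⟩
    · by_cases hju : j = u
      · subst hju
        rw [Equiv.swap_apply_left] at hjk
        rw [blockA_mul_apply_left huv, ih0 _ _ hjk, ih0 _ _ (hσ.trans hjk)]
        simp
      by_cases hjv : j = v
      · subst hjv
        rw [Equiv.swap_apply_right] at hjk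
        rw [blockA_mul_apply_right huv, ih0 _ _ hjk, mul_zero]
      rw [Equiv.swap_apply_of_ne_of_ne hju hjv] at hjk
      rw [blockA_mul_apply_of_ne huv _ _ _ _ _ hju hjv, ih0 _ _ hjk]
    · obtain ⟨hb, hc⟩ := hbc _ List.mem_cons_self
      have ih1 := ih1 fun t ht => hbc t (List.mem_cons_of_mem _ ht)
      by_cases hju : j = u
      · subst hju
        rw [Equiv.swap_apply_left, blockA_mul_apply_left huv, ih0 _ _ hσ, mul_zero, zero_add]
        exact mul_ne_zero hb (ih1 v)
      by_cases hjv : j = v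
      · subst hjv
        rw [Equiv.swap_apply_right, blockA_mul_apply_right huv]
        exact mul_ne_zero hc (ih1 u)
      rw [Equiv.swap_apply_of_ne_of_ne hju hjv, blockA_mul_apply_of_ne huv _ _ _ _ _ hju hjv]
      exact ih1 j

/-- Long products along a reduced decomposition of the longest element of `S(n)` are
c-upper triangular: if `s_{i₁}⋯s_{i_N} = w₀` (the reversal of `{1,…,n}`,
`N = n(n-1)/2`), then `M = A(a₁,b₁,c₁)_{i₁}⋯A(a_N,b_N,c_N)_{i_N}` satisfies `M j k = 0`
whenever `j + k > n + 1` (1-based), and if all `b_m, c_m` are nonzero, then all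
antidiagonal entries of `M` are nonzero. -/
theorem long_product_c_upper_triangular {K : Type*} [Field K]
    (n N : ℕ) (hn : 2 ≤ n) (hN : N = n * (n - 1) / 2)
    (i : Fin N → ℕ) (hi : ∀ m, 1 ≤ i m ∧ i m ≤ n - 1)
    (hred : (List.ofFn fun m => adjSwap n (i m)).prod = Fin.revPerm)
    (a b c : Fin N → K) :
    (∀ j k : Fin n,
        n < (j : ℕ) + (k : ℕ) + 1 →
        (List.ofFn fun m => blockA n (i m - 1) (a m) (b m) (c m)).prod j k = 0) ∧
    ((∀ m, b m ≠ 0) → (∀ m, c m ≠ 0) →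
      ∀ j : Fin n,
        (List.ofFn fun m => blockA n (i m - 1) (a m) (b m) (c m)).prod j j.rev ≠ 0) := by
  have hrev : (Fin.revPerm : Equiv.Perm (Fin n))⁻¹ = Fin.revPerm := rfl
  have key := prod_blockA_apply_of_reduced (n := n)
    (List.ofFn fun m => (i m, a m, b m, c m)) (by
      intro t ht
      obtain ⟨m, rfl⟩ := (List.mem_ofFn' _ _).1 ht
      have := hi m
      simp only
      omega)
  simp only [List.map_ofFn, Function.comp_def, hred, hrev, List.length_ofFn,
    card_inversions_revPerm, Fin.revPerm_apply] at key
  obtain ⟨h0, h1⟩ := key hN.symm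
  refine ⟨fun j k hjk => h0 j k ?_, fun hb hc => h1 ?_⟩
  · rw [Fin.lt_def, Fin.val_rev]
    omega
  · intro t ht
    obtain ⟨m, rfl⟩ := (List.mem_ofFn' _ _).1 ht
    exact ⟨hb m, hc m⟩
end
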